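/- (Finite-field Dixon formula.) Assume the characteristic p of κ is odd. Let α, β, γ be multiplicative characters of κ such that α² ≠ βγ, and such that for each of the two multiplicative characters α' with α'² = α², the multiset {β,γ} is not equal to the multiset {ε,α'}. Then F(α², β, γ; α²β̄, α²γ̄; 1) = ∑_{α' : α'² = α²} [g°(α²β̄)·g°(α²γ̄)·g(α')·g(α'β̄γ̄)] / [g(α²)·g(α²β̄γ̄)·g°(α'β̄)·g°(α'γ̄)]. -/

import Mathlib

/-!
Finite-field hypergeometric functions (Otsubo), basic definitions:
`κ` is a finite field with `q = Fintype.card κ` elements, `ψ` a fixed nontrivial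
additive character, multiplicative characters are `MulChar κ ℂ` (extended by `0`
on `0`, with trivial character `1`).
-/

open scoped Classical

noncomputable section

variable {κ : Type*} [Field κ] [Fintype κ]

instance : Fintype (MulChar κ ℂ) := Fintype.ofFinite _

/-- The Gauss sum `g(φ) = -∑_{x ∈ κ} ψ(x) φ(x)`. -/
def gS (ψ : AddChar κ ℂ) (φ : MulChar κ ℂ) : ℂ := -∑ x : κ, ψ x * φ x

/-- The variant `g°(φ) = q^{δ(φ)} · g(φ)`, where `δ(φ) = 1` iff `φ` is trivial. -/
def gSo (ψ : AddChar κ ℂ) (φ : MulChar κ ℂ) : ℂ :=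
  (if φ = 1 then (Fintype.card κ : ℂ) else 1) * gS ψ φ

/-- The Pochhammer symbol `(α)_ν = g(αν)/g(α)`. -/
def poch (ψ : AddChar κ ℂ) (α ν : MulChar κ ℂ) : ℂ := gS ψ (α * ν) / gS ψ α

/-- The variant Pochhammer symbol `(α)°_ν = g°(αν)/g°(α)`. -/
def pocho (ψ : AddChar κ ℂ) (α ν : MulChar κ ℂ) : ℂ := gSo ψ (α * ν) / gSo ψ α

/-- The finite hypergeometric function
`F(α₁,…,α_r; β₁,…,β_s; λ) = (1/(1-q)) ∑_ν ((α₁)_ν ⋯ (α_r)_ν / ((ε)°_ν (β₁)°_ν ⋯ (β_s)°_ν)) ν(λ)`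
(the trivial character `ε = 1` appears implicitly among the lower parameters). -/
def Fh (ψ : AddChar κ ℂ) {r s : ℕ} (A : Fin r → MulChar κ ℂ) (B : Fin s → MulChar κ ℂ)
    (l : κ) : ℂ :=
  (1 - (Fintype.card κ : ℂ))⁻¹ *
    ∑ ν : MulChar κ ℂ,
      ((∏ i, poch ψ (A i) ν) / (pocho ψ 1 ν * ∏ j, pocho ψ (B j) ν)) * ν l

/-- The twisted Gauss sum `∑_z ψ(sz) φ(z)`. -/
def gaussTwist (ψ : AddChar κ ℂ) (φ : MulChar κ ℂ) (s : κ) : ℂ := ∑ z : κ, ψ (s * z) * φ z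

lemma card_ne_zero_complex : (Fintype.card κ : ℂ) ≠ 0 :=
  Nat.cast_ne_zero.mpr Fintype.card_ne_zero

lemma one_sub_card_ne_zero : (1 - Fintype.card κ : ℂ) ≠ 0 := by
  rw [sub_ne_zero]
  exact_mod_cast (Fintype.one_lt_card (α := κ)).ne

lemma mulChar_neg_one_mul_self {F : Type*} [Field F] (φ : MulChar F ℂ) : φ (-1) * φ (-1) = 1 := by
  rw [← map_mul]; simp

lemma mulChar_inv_neg_one {F : Type*} [Field F] (φ : MulChar F ℂ) : φ⁻¹ (-1) = φ (-1) := by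
  rw [MulChar.inv_apply', inv_neg_one]

lemma gS_eq_neg_gaussSum (ψ : AddChar κ ℂ) (φ : MulChar κ ℂ) : gS ψ φ = -gaussSum φ ψ := by
  simp [gS, gaussSum, mul_comm]

lemma gS_one {ψ : AddChar κ ℂ} (hψ : ψ ≠ 1) : gS ψ 1 = 1 := by
  rw [gS_eq_neg_gaussSum, gaussSum_one_left hψ, neg_neg]

lemma gSo_of_ne_one (ψ : AddChar κ ℂ) {φ : MulChar κ ℂ} (h : φ ≠ 1) : gSo ψ φ = gS ψ φ := by
  simp [gSo, h]

lemma gSo_one {ψ : AddChar κ ℂ} (hψ : ψ ≠ 1) : gSo ψ 1 = Fintype.card κ := by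
  simp [gSo, gS_one hψ]

lemma gS_inv_mul_gSo {ψ : AddChar κ ℂ} (hψ : ψ ≠ 1) (φ : MulChar κ ℂ) :
    gS ψ φ⁻¹ * gSo ψ φ = φ (-1) * Fintype.card κ := by
  by_cases h : φ = 1
  · subst h
    rw [inv_one, gS_one hψ, gSo_one hψ, MulChar.one_apply (by simp)]
  · rw [gSo_of_ne_one ψ h, gS_eq_neg_gaussSum, gS_eq_neg_gaussSum, neg_mul_neg,
      ← mul_gaussSum_inv_eq_gaussSum φ⁻¹, mulChar_inv_neg_one, mul_assoc, mul_comm (gaussSum _ _),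
      gaussSum_mul_gaussSum_eq_card h (AddChar.IsPrimitive.of_ne_one hψ)]

lemma gSo_ne_zero {ψ : AddChar κ ℂ} (hψ : ψ ≠ 1) (φ : MulChar κ ℂ) : gSo ψ φ ≠ 0 := by
  intro h
  have := gS_inv_mul_gSo hψ φ
  rw [h, mul_zero] at this
  have h1 := mulChar_neg_one_mul_self φ
  rcases mul_eq_zero.mp this.symm with h2 | h2
  · simp [h2] at h1
  · exact card_ne_zero_complex h2

lemma gS_ne_zero {ψ : AddChar κ ℂ} (hψ : ψ ≠ 1) (φ : MulChar κ ℂ) : gS ψ φ ≠ 0 :=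
  right_ne_zero_of_mul (gSo_ne_zero hψ φ)

lemma inv_gSo {ψ : AddChar κ ℂ} (hψ : ψ ≠ 1) (φ : MulChar κ ℂ) :
    (gSo ψ φ)⁻¹ = φ (-1) * gS ψ φ⁻¹ / Fintype.card κ := by
  have h1 := gS_inv_mul_gSo hψ φ
  have h2 := mulChar_neg_one_mul_self φ
  have h3 := card_ne_zero_complex (κ := κ)
  refine inv_eq_of_mul_eq_one_left ?_
  field_simp
  linear_combination φ (-1) * h1 + Fintype.card κ * h2

lemma gaussTwist_of_ne_zero (ψ : AddChar κ ℂ) (φ : MulChar κ ℂ) {s : κ} (hs : s ≠ 0) :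
    gaussTwist ψ φ s = -(φ⁻¹ s * gS ψ φ) := by
  rw [gaussTwist, gS, mul_neg, neg_neg, Finset.mul_sum]
  refine Fintype.sum_bijective _ (mulLeft_bijective₀ s hs) _ _ fun z ↦ ?_
  have : φ s ≠ 0 := by simpa [MulChar.apply_eq_zero_iff] using hs
  rw [map_mul φ, MulChar.inv_apply_eq_inv']
  field_simp

lemma gaussTwist_zero_of_ne_one (ψ : AddChar κ ℂ) {φ : MulChar κ ℂ} (h : φ ≠ 1) :
    gaussTwist ψ φ 0 = 0 := by
  simp [gaussTwist, MulChar.sum_eq_zero_of_ne_one h]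

lemma gaussTwist_mul_gaussTwist (ψ : AddChar κ ℂ) (φ : MulChar κ ℂ) {s t : κ}
    (h : s ≠ 0 ∨ t ≠ 0) :
    gaussTwist ψ φ s * gaussTwist ψ φ t = -(gS ψ φ * gaussTwist ψ φ (s * t)) := by
  wlog hs : s ≠ 0 generalizing s t
  · rw [mul_comm, this h.symm (by tauto), mul_comm t]
  by_cases ht : t = 0
  · subst ht
    rw [mul_zero]
    by_cases hφ : φ = 1
    · subst hφ
      rw [gaussTwist_of_ne_zero ψ _ hs, inv_one, MulChar.one_apply hs.isUnit]
      ring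
    · simp [gaussTwist_zero_of_ne_one ψ hφ]
  · rw [gaussTwist_of_ne_zero ψ _ hs, gaussTwist_of_ne_zero ψ _ ht,
      gaussTwist_of_ne_zero ψ _ (mul_ne_zero hs ht), map_mul]
    ring

lemma gS_mul_gS (ψ : AddChar κ ℂ) (φ χ : MulChar κ ℂ) :
    gS ψ φ * gS ψ χ = ∑ t, φ t * gaussTwist ψ (φ * χ) (1 + t) := by
  simp only [gS, gaussTwist, neg_mul_neg, Finset.mul_sum]
  rw [Finset.sum_comm (s := Finset.univ (α := κ)) (t := Finset.univ (α := κ))]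
  refine Finset.sum_congr rfl fun z _ ↦ ?_
  by_cases hz : z = 0
  · simp [hz, MulChar.map_zero]
  rw [Finset.sum_mul]
  symm
  refine Fintype.sum_bijective _ (mulRight_bijective₀ z hz) _ _ fun t ↦ ?_
  rw [MulChar.mul_apply, map_mul φ, add_mul, one_mul, AddChar.map_add_eq_mul]
  ring

lemma card_mulChar : (Fintype.card (MulChar κ ℂ) : ℂ) = Fintype.card κ - 1 := by
  rw [← Nat.card_eq_fintype_card, MulChar.card_eq_card_units_of_hasEnoughRootsOfUnity,
    Nat.card_eq_fintype_card, Fintype.card_units, Nat.cast_sub Fintype.card_pos, Nat.cast_one]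

lemma sum_mulChar_apply (x : κ) :
    ∑ μ : MulChar κ ℂ, μ x = if x = 1 then (Fintype.card κ - 1 : ℂ) else 0 := by
  split_ifs with h
  · simp [h, card_mulChar]
  · obtain ⟨χ, hχ⟩ := MulChar.exists_apply_ne_one_of_hasEnoughRootsOfUnity κ ℂ h
    refine eq_zero_of_mul_eq_self_left hχ ?_
    simp only [Finset.mul_sum, ← MulChar.mul_apply]
    exact Fintype.sum_bijective _ (Group.mulLeft_bijective χ) _ _ fun χ' ↦ rfl

/-- Parseval's identity for multiplicative characters. -/
lemma sum_mulChar_transform_mul (F G : κ → ℂ) (hF : F 0 = 0) :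
    ∑ χ : MulChar κ ℂ, (∑ t, χ t * F t) * (∑ s, χ⁻¹ s * G s) =
      (Fintype.card κ - 1 : ℂ) * ∑ t, F t * G t := by
  have key (t s : κ) : ∑ χ : MulChar κ ℂ, χ t * F t * (χ⁻¹ s * G s) =
      if s = t then (Fintype.card κ - 1 : ℂ) * (F t * G t) else 0 := by
    have : ∑ χ : MulChar κ ℂ, χ t * F t * (χ⁻¹ s * G s) =
        F t * G s * ∑ χ : MulChar κ ℂ, χ (t * s⁻¹) := by
      rw [Finset.mul_sum]
      refine Finset.sum_congr rfl fun χ _ ↦ ?_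
      rw [map_mul, MulChar.inv_apply']
      ring
    rw [this, sum_mulChar_apply]
    by_cases ht : t = 0
    · simp [ht, hF]
    by_cases hs : s = 0
    · simp [hs, Ne.symm ht]
    · rw [mul_inv_eq_one₀ hs]
      by_cases h : s = t
      · simp [h]; ring
      · simp [h, Ne.symm h]
  simp only [Finset.sum_mul_sum]
  rw [Finset.sum_comm, Finset.mul_sum]
  refine Finset.sum_congr rfl fun t _ ↦ ?_
  rw [Finset.sum_comm]
  simp [key]

lemma jacobiSum_eq_gS {ψ : AddChar κ ℂ} (hψ : ψ ≠ 1) {φ χ : MulChar κ ℂ} (h : φ = 1 → χ ≠ 1) :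
    jacobiSum φ χ = -(gS ψ φ * gS ψ χ / gSo ψ (φ * χ)) := by
  by_cases hm : φ * χ = 1
  · have hφ : φ ≠ 1 := by
      rintro rfl
      exact h rfl (by simpa using hm)
    obtain rfl : χ = φ⁻¹ := eq_inv_of_mul_eq_one_right hm
    have := gS_inv_mul_gSo hψ φ
    rw [gSo_of_ne_one ψ hφ] at this
    rw [jacobiSum_nontrivial_inv hφ, hm, gSo_one hψ, mul_comm, this,
      mul_div_cancel_right₀ _ card_ne_zero_complex]
  · have := jacobiSum_mul_nontrivial hm ψ
    have h0 := gS_ne_zero hψ (φ * χ)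
    rw [gSo_of_ne_one ψ hm]
    rw [← neg_div, eq_div_iff h0]
    simp only [gS_eq_neg_gaussSum]
    linear_combination -this

lemma sum_mulChar_mul_mulChar_one_add (φ χ : MulChar κ ℂ) :
    ∑ t, φ t * χ (1 + t) = φ (-1) * jacobiSum φ χ := by
  rw [jacobiSum, Finset.mul_sum]
  refine Fintype.sum_equiv (Equiv.neg κ) _ _ fun t ↦ ?_
  rw [← mul_assoc, ← map_mul]
  simp

/-- The finite-field analogue of Barnes's first lemma. -/
lemma sum_gS_mul_gS_mul_gS_mul_gS {ψ : AddChar κ ℂ} (hψ : ψ ≠ 1) (A B C D : MulChar κ ℂ)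
    (h : A * B * C * D = 1 → A * C ≠ 1 ∧ A * D ≠ 1) :
    ∑ χ, gS ψ (A * χ) * gS ψ (B * χ) * gS ψ (C * χ⁻¹) * gS ψ (D * χ⁻¹) =
      (1 - Fintype.card κ) * (gS ψ (A * C) * gS ψ (A * D) * gS ψ (B * C) * gS ψ (B * D)) /
        gSo ψ (A * B * C * D) := by
  have h1 (χ : MulChar κ ℂ) :
      gS ψ (A * χ) * gS ψ (B * χ) * gS ψ (C * χ⁻¹) * gS ψ (D * χ⁻¹) =
      (∑ t, χ t * (A t * gaussTwist ψ (A * C) (1 + t))) *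
        (∑ s, χ⁻¹ s * (D s * gaussTwist ψ (B * D) (1 + s))) := by
    have e1 := gS_mul_gS ψ (A * χ) (C * χ⁻¹)
    have e2 := gS_mul_gS ψ (D * χ⁻¹) (B * χ)
    rw [show A * χ * (C * χ⁻¹) = A * C by rw [mul_mul_mul_comm]; simp] at e1
    rw [show D * χ⁻¹ * (B * χ) = B * D by rw [mul_mul_mul_comm, mul_comm D B]; simp] at e2
    calc _ = (gS ψ (A * χ) * gS ψ (C * χ⁻¹)) * (gS ψ (D * χ⁻¹) * gS ψ (B * χ)) := by ring
      _ = _ := by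
        rw [e1, e2]
        congr 1 <;>
        · refine Finset.sum_congr rfl fun t _ ↦ ?_
          rw [MulChar.mul_apply]
          ring
  have hABCD : (A * C) * (B * D) = A * B * C * D := by
    rw [mul_mul_mul_comm, mul_assoc (A * B)]
  have h2 (t : κ) : A t * gaussTwist ψ (A * C) (1 + t) * (D t * gaussTwist ψ (B * D) (1 + t)) =
      gS ψ (A * C) * gS ψ (B * D) * ((A * D) t * (A * B * C * D)⁻¹ (1 + t)) := by
    by_cases ht : 1 + t = 0
    · rw [ht, MulChar.map_zero, mul_zero, mul_zero]
      by_cases hAC : A * C = 1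
      · have hBD : B * D ≠ 1 := fun hBD ↦ (h (by rw [← hABCD, hAC, hBD, one_mul])).1 hAC
        simp [gaussTwist_zero_of_ne_one ψ hBD]
      · simp [gaussTwist_zero_of_ne_one ψ hAC]
    · rw [gaussTwist_of_ne_zero ψ _ ht, gaussTwist_of_ne_zero ψ _ ht, ← hABCD,
        MulChar.mul_apply A D, mul_inv (A * C), MulChar.mul_apply (A * C)⁻¹]
      ring
  rw [Finset.sum_congr rfl fun χ _ ↦ h1 χ, sum_mulChar_transform_mul _ _
      (by rw [MulChar.map_zero, zero_mul]),
    Finset.sum_congr rfl fun t _ ↦ h2 t, ← Finset.mul_sum, sum_mulChar_mul_mulChar_one_add,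
    jacobiSum_eq_gS hψ fun h3 h4 ↦ (h (inv_eq_one.mp h4)).2 h3]
  have hBC : A * D * (A * B * C * D)⁻¹ = (B * C)⁻¹ := by
    rw [eq_inv_iff_mul_eq_one, mul_right_comm, mul_inv_eq_one]
    simp only [mul_comm, mul_left_comm]
  have hs : (A * D) (-1) * (B * C) (-1) = (A * B * C * D) (-1) := by
    simp only [MulChar.mul_apply]
    ring
  rw [hBC, div_eq_mul_inv _ (gSo ψ (B * C)⁻¹), div_eq_mul_inv _ (gSo ψ (A * B * C * D)),
    inv_gSo hψ, inv_gSo hψ, inv_inv, mulChar_inv_neg_one, ← hs]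
  ring

/-- The sum of the values at `w` of the square roots of a character `a` equals the sum of the
values of `a` at the square roots of `w`. -/
lemma sum_mulChar_sq_eq (a : MulChar κ ℂ) (w : κ) :
    ∑ α' ∈ Finset.univ.filter (fun α' : MulChar κ ℂ => α' ^ 2 = a), α' w =
      ∑ t ∈ Finset.univ.filter (fun t : κ => t ^ 2 = w), a t := by
  by_cases hw : w = 0
  · subst hw
    simp [Finset.sum_filter, MulChar.map_zero]
  have hq := one_sub_card_ne_zero (κ := κ)
  have h1 (t : κ) : (∑ μ : MulChar κ ℂ, μ w * (μ⁻¹ ^ 2 * a) t) =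
      if t ^ 2 = w then (Fintype.card κ - 1) * a t else 0 := by
    by_cases ht : t = 0
    · simp [ht, MulChar.map_zero]
    have : (∑ μ : MulChar κ ℂ, μ w * (μ⁻¹ ^ 2 * a) t) =
        a t * ∑ μ : MulChar κ ℂ, μ (w * (t ^ 2)⁻¹) := by
      rw [Finset.mul_sum]
      refine Finset.sum_congr rfl fun μ _ ↦ ?_
      rw [MulChar.mul_apply, MulChar.pow_apply' _ two_ne_zero, MulChar.inv_apply', map_mul,
        ← inv_pow, map_pow]
      ring
    rw [this, sum_mulChar_apply, mul_inv_eq_one₀ (pow_ne_zero 2 ht)]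
    by_cases h : t ^ 2 = w
    · simp [h, mul_comm]
    · simp [h, Ne.symm h]
  have h2 (μ : MulChar κ ℂ) : (∑ t, μ w * (μ⁻¹ ^ 2 * a) t) =
      if μ ^ 2 = a then (Fintype.card κ - 1) * μ w else 0 := by
    rw [← Finset.mul_sum]
    split_ifs with h
    · rw [← h, inv_pow, inv_mul_cancel, MulChar.sum_one_eq_card_units, Fintype.card_units,
        Nat.cast_sub Fintype.card_pos, Nat.cast_one, mul_comm]
    · rw [MulChar.sum_eq_zero_of_ne_one, mul_zero]
      rw [inv_pow, ne_eq, inv_mul_eq_one]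
      exact h
  have h3 := Finset.sum_comm (s := (Finset.univ : Finset κ))
    (t := (Finset.univ : Finset (MulChar κ ℂ))) (f := fun t μ ↦ μ w * (μ⁻¹ ^ 2 * a) t)
  simp only [h1, h2] at h3
  rw [← Finset.sum_filter, ← Finset.sum_filter, ← Finset.mul_sum, ← Finset.mul_sum] at h3
  refine (mul_left_cancel₀ ?_ h3).symm
  rwa [← neg_ne_zero, neg_sub]

/-- The finite-field analogue of Kummer's summation formula, in terms of Gauss sums. -/
lemma sum_gS_kummer (hp : ringChar κ ≠ 2) (ψ : AddChar κ ℂ) (a χ : MulChar κ ℂ) :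
    ∑ ν : MulChar κ ℂ, ν (-1) * gS ψ (a * ν) * gS ψ ν⁻¹ * gS ψ (ν * χ) *
        gS ψ (a⁻¹ * ν⁻¹ * χ) =
      (1 - Fintype.card κ) * (gS ψ χ *
        ∑ α' ∈ Finset.univ.filter (fun α' : MulChar κ ℂ => α' ^ 2 = a),
          α' (-1) * gS ψ α' * gS ψ (α'⁻¹ * χ)) := by
  have neg_sum (φ θ : MulChar κ ℂ) :
      φ (-1) * (gS ψ φ * gS ψ (φ⁻¹ * θ)) = ∑ t, φ t * gaussTwist ψ θ (1 - t) := by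
    rw [gS_mul_gS, mul_inv_cancel_left, Finset.mul_sum]
    refine Fintype.sum_equiv (Equiv.neg κ) _ _ fun t ↦ ?_
    rw [← mul_assoc, ← map_mul]
    simp
  have h1 (ν : MulChar κ ℂ) :
      ν (-1) * gS ψ (a * ν) * gS ψ ν⁻¹ * gS ψ (ν * χ) * gS ψ (a⁻¹ * ν⁻¹ * χ) =
      (∑ t, ν t * (a t * gaussTwist ψ χ (1 + t))) *
        (∑ s, ν⁻¹ s * gaussTwist ψ χ (1 - s)) := by
    have e1 := gS_mul_gS ψ (a * ν) (a⁻¹ * ν⁻¹ * χ)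
    have e2 := neg_sum ν⁻¹ χ
    rw [← mul_inv, mul_inv_cancel_left] at e1
    rw [inv_inv, mulChar_inv_neg_one] at e2
    calc _ = (gS ψ (a * ν) * gS ψ ((a * ν)⁻¹ * χ)) *
          (ν (-1) * (gS ψ ν⁻¹ * gS ψ (ν * χ))) := by rw [mul_inv]; ring
      _ = _ := by
        rw [e1, e2]
        congr 1
        refine Finset.sum_congr rfl fun t _ ↦ ?_
        rw [MulChar.mul_apply]
        ring
  have h2 (t : κ) : a t * gaussTwist ψ χ (1 + t) * gaussTwist ψ χ (1 - t) =
      -(gS ψ χ * (a t * gaussTwist ψ χ (1 - t ^ 2))) := by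
    have h0 : 1 + t ≠ 0 ∨ 1 - t ≠ 0 := by
      by_contra! h0
      refine Ring.two_ne_zero hp ?_
      linear_combination h0.1 + h0.2
    rw [mul_assoc, gaussTwist_mul_gaussTwist ψ χ h0, show (1 + t) * (1 - t) = 1 - t ^ 2 by ring]
    ring
  have h3 : ∑ α' ∈ Finset.univ.filter (fun α' : MulChar κ ℂ => α' ^ 2 = a),
      α' (-1) * gS ψ α' * gS ψ (α'⁻¹ * χ) = ∑ t, a t * gaussTwist ψ χ (1 - t ^ 2) := by
    simp only [mul_assoc, neg_sum]
    rw [Finset.sum_comm]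
    simp only [← Finset.sum_mul, sum_mulChar_sq_eq]
    rw [← Finset.sum_fiberwise Finset.univ (fun t : κ ↦ t ^ 2)
      (fun t ↦ a t * gaussTwist ψ χ (1 - t ^ 2))]
    refine Finset.sum_congr rfl fun w _ ↦ ?_
    rw [Finset.sum_mul]
    refine Finset.sum_congr rfl fun t ht ↦ ?_
    rw [(Finset.mem_filter.mp ht).2]
  rw [Finset.sum_congr rfl fun ν _ ↦ h1 ν, sum_mulChar_transform_mul _ _
      (by rw [MulChar.map_zero, zero_mul]),
    Finset.sum_congr rfl fun t _ ↦ h2 t, h3, Finset.sum_neg_distrib, ← Finset.mul_sum]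
  ring

/-- Dixon's formula as an evaluation of a sum of products of six Gauss sums. -/
lemma sum_gS_dixon (hp : ringChar κ ≠ 2) {ψ : AddChar κ ℂ} (hψ : ψ ≠ 1)
    (a β γ : MulChar κ ℂ) (h1 : a ≠ β * γ)
    (h2 : ∀ α' : MulChar κ ℂ, α' ^ 2 = a → α'⁻¹ * β * γ = 1 → β ≠ 1 ∧ γ ≠ 1) :
    ∑ ν : MulChar κ ℂ, ν (-1) * gS ψ (a * ν) * gS ψ (β * ν) * gS ψ (γ * ν) * gS ψ ν⁻¹ *
        gS ψ (a⁻¹ * β * ν⁻¹) * gS ψ (a⁻¹ * γ * ν⁻¹) =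
      (1 - Fintype.card κ) * (gS ψ (a⁻¹ * β * γ) *
        ∑ α' ∈ Finset.univ.filter (fun α' : MulChar κ ℂ => α' ^ 2 = a),
          α' (-1) * gS ψ α' * (gS ψ β * gS ψ γ * gS ψ (α'⁻¹ * β) * gS ψ (α'⁻¹ * γ)) /
            gSo ψ (α'⁻¹ * β * γ)) := by
  have hq := one_sub_card_ne_zero (κ := κ)
  have hne : a⁻¹ * β * γ ≠ 1 := by
    rw [mul_assoc, ne_eq, inv_mul_eq_one]
    exact h1
  have hG := gS_ne_zero hψ (a⁻¹ * β * γ)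
  have e1 (ν : MulChar κ ℂ) :
      (1 - Fintype.card κ) * (gS ψ (β * ν) * gS ψ (γ * ν) *
        gS ψ (a⁻¹ * β * ν⁻¹) * gS ψ (a⁻¹ * γ * ν⁻¹)) = gS ψ (a⁻¹ * β * γ) *
      ∑ χ, gS ψ (ν * χ) * gS ψ (a⁻¹ * ν⁻¹ * χ) * gS ψ (β * χ⁻¹) * gS ψ (γ * χ⁻¹) := by
    have hm : ν * (a⁻¹ * ν⁻¹) * β * γ = a⁻¹ * β * γ := by
      rw [mul_comm a⁻¹, mul_inv_cancel_left]
    rw [sum_gS_mul_gS_mul_gS_mul_gS hψ _ _ _ _ fun h ↦ absurd (hm.symm.trans h) hne, hm,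
      gSo_of_ne_one ψ hne, mul_div_cancel₀ _ hG, mul_right_comm a⁻¹ ν⁻¹ β,
      mul_right_comm a⁻¹ ν⁻¹ γ,
      mul_comm ν β, mul_comm ν γ]
  have e2 (α' : MulChar κ ℂ) (hα : α' ^ 2 = a) :
      ∑ χ, gS ψ χ * gS ψ (α'⁻¹ * χ) * gS ψ (β * χ⁻¹) * gS ψ (γ * χ⁻¹) =
      (1 - Fintype.card κ) * (gS ψ β * gS ψ γ * gS ψ (α'⁻¹ * β) * gS ψ (α'⁻¹ * γ)) /
        gSo ψ (α'⁻¹ * β * γ) := by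
    simpa using sum_gS_mul_gS_mul_gS_mul_gS hψ 1 α'⁻¹ β γ (by simpa using h2 α' hα)
  refine mul_left_cancel₀ hq ?_
  calc _ = ∑ ν : MulChar κ ℂ, ∑ χ : MulChar κ ℂ, gS ψ (a⁻¹ * β * γ) *
        (gS ψ (β * χ⁻¹) * gS ψ (γ * χ⁻¹) * (ν (-1) * gS ψ (a * ν) * gS ψ ν⁻¹ * gS ψ (ν * χ) *
          gS ψ (a⁻¹ * ν⁻¹ * χ))) := by
        rw [Finset.mul_sum]
        refine Finset.sum_congr rfl fun ν _ ↦ ?_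
        calc _ = ν (-1) * gS ψ (a * ν) * gS ψ ν⁻¹ * ((1 - Fintype.card κ) *
              (gS ψ (β * ν) * gS ψ (γ * ν) * gS ψ (a⁻¹ * β * ν⁻¹) *
                gS ψ (a⁻¹ * γ * ν⁻¹))) := by ring
          _ = _ := by
            rw [e1, Finset.mul_sum, Finset.mul_sum]
            refine Finset.sum_congr rfl fun χ _ ↦ ?_
            ring
    _ = gS ψ (a⁻¹ * β * γ) * ∑ χ : MulChar κ ℂ, gS ψ (β * χ⁻¹) * gS ψ (γ * χ⁻¹) *
        ((1 - Fintype.card κ) * (gS ψ χ *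
        ∑ α' ∈ Finset.univ.filter (fun α' : MulChar κ ℂ => α' ^ 2 = a),
          α' (-1) * gS ψ α' * gS ψ (α'⁻¹ * χ))) := by
        rw [Finset.sum_comm, Finset.mul_sum]
        simp only [← Finset.mul_sum, sum_gS_kummer hp ψ]
    _ = gS ψ (a⁻¹ * β * γ) * ((1 - Fintype.card κ) *
        ∑ α' ∈ Finset.univ.filter (fun α' : MulChar κ ℂ => α' ^ 2 = a), α' (-1) * gS ψ α' *
          ∑ χ, gS ψ χ * gS ψ (α'⁻¹ * χ) * gS ψ (β * χ⁻¹) * gS ψ (γ * χ⁻¹)) := by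
        congr 1
        simp only [Finset.mul_sum]
        rw [Finset.sum_comm]
        refine Finset.sum_congr rfl fun α' _ ↦ Finset.sum_congr rfl fun χ _ ↦ ?_
        ring
    _ = _ := by
        rw [mul_left_comm]
        congr 1
        rw [mul_left_comm]
        congr 1
        rw [Finset.mul_sum]
        refine Finset.sum_congr rfl fun α' hα ↦ ?_
        rw [e2 α' (Finset.mem_filter.mp hα).2]
        ring

/-- The summand of the hypergeometric function in Dixon's formula as a product of Gauss sums. -/
lemma dixon_summand_eq {ψ : AddChar κ ℂ} (hψ : ψ ≠ 1) (α β γ ν : MulChar κ ℂ) :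
    (∏ i, poch ψ (![α ^ 2, β, γ] i) ν) /
      (pocho ψ 1 ν * ∏ j, pocho ψ (![α ^ 2 * β⁻¹, α ^ 2 * γ⁻¹] j) ν) * ν 1 =
    gSo ψ (α ^ 2 * β⁻¹) * gSo ψ (α ^ 2 * γ⁻¹) * β (-1) * γ (-1) /
      (gS ψ (α ^ 2) * gS ψ β * gS ψ γ * Fintype.card κ ^ 2) *
    (ν (-1) * gS ψ (α ^ 2 * ν) * gS ψ (β * ν) * gS ψ (γ * ν) * gS ψ ν⁻¹ *
      gS ψ ((α ^ 2)⁻¹ * β * ν⁻¹) * gS ψ ((α ^ 2)⁻¹ * γ * ν⁻¹)) := by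
  have hc := card_ne_zero_complex (κ := κ)
  have ha : (α ^ 2) (-1) = 1 := by
    rw [pow_two, MulChar.mul_apply, mulChar_neg_one_mul_self]
  have i1 := inv_gSo hψ ν
  have i2 := inv_gSo hψ (α ^ 2 * β⁻¹ * ν)
  have i3 := inv_gSo hψ (α ^ 2 * γ⁻¹ * ν)
  simp only [mul_inv, inv_inv, MulChar.mul_apply, ha, mulChar_inv_neg_one] at i2 i3
  simp only [Fin.prod_univ_two, Fin.prod_univ_three, Matrix.cons_val_zero, Matrix.cons_val_one,
    Matrix.cons_val, poch, pocho, one_mul, map_one, mul_one, gSo_one hψ]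
  simp only [div_eq_mul_inv, mul_inv, inv_inv, i1, i2, i3]
  have hν := mulChar_neg_one_mul_self ν
  generalize gS ψ (α ^ 2 * ν) = x₁, gS ψ (β * ν) = x₂, gS ψ (γ * ν) = x₃, gS ψ ν⁻¹ = x₄,
    gS ψ ((α ^ 2)⁻¹ * β * ν⁻¹) = x₅, gS ψ ((α ^ 2)⁻¹ * γ * ν⁻¹) = x₆, (gS ψ (α ^ 2))⁻¹ = y₁,
    (gS ψ β)⁻¹ = y₂, (gS ψ γ)⁻¹ = y₃, gSo ψ (α ^ 2 * β⁻¹) = z₁, gSo ψ (α ^ 2 * γ⁻¹) = z₂,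
    β (-1) = b, γ (-1) = c, ν (-1) = u, (Fintype.card κ : ℂ) = q at hν hc ⊢
  have hq := mul_inv_cancel₀ hc
  rw [← inv_pow]
  generalize q⁻¹ = r at hq ⊢
  linear_combination (x₁ * x₂ * x₃ * x₄ * x₅ * x₆ * y₁ * y₂ * y₃ * z₁ * z₂ * b * c * u * r ^ 2) *
    (u * u * hq + hν)

lemma dixon_rhs_term_eq {ψ : AddChar κ ℂ} (hψ : ψ ≠ 1) {α β γ : MulChar κ ℂ}
    (hne : α ^ 2 * β⁻¹ * γ⁻¹ ≠ 1) (α' : MulChar κ ℂ) :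
    gSo ψ (α ^ 2 * β⁻¹) * gSo ψ (α ^ 2 * γ⁻¹) * gS ψ α' * gS ψ (α' * β⁻¹ * γ⁻¹) /
      (gS ψ (α ^ 2) * gS ψ (α ^ 2 * β⁻¹ * γ⁻¹) * gSo ψ (α' * β⁻¹) * gSo ψ (α' * γ⁻¹)) =
    gSo ψ (α ^ 2 * β⁻¹) * gSo ψ (α ^ 2 * γ⁻¹) * β (-1) * γ (-1) /
      (gS ψ (α ^ 2) * gS ψ β * gS ψ γ * Fintype.card κ ^ 2) * (gS ψ ((α ^ 2)⁻¹ * β * γ) *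
      (α' (-1) * gS ψ α' * (gS ψ β * gS ψ γ * gS ψ (α'⁻¹ * β) * gS ψ (α'⁻¹ * γ)) /
          gSo ψ (α'⁻¹ * β * γ))) := by
  have ha : (α ^ 2) (-1) = 1 := by
    rw [pow_two, MulChar.mul_apply, mulChar_neg_one_mul_self]
  have i1 := inv_gSo hψ (α ^ 2 * β⁻¹ * γ⁻¹)
  have i2 := inv_gSo hψ (α' * β⁻¹)
  have i3 := inv_gSo hψ (α' * γ⁻¹)
  have i4 := inv_gSo hψ (α'⁻¹ * β * γ)
  rw [gSo_of_ne_one ψ hne] at i1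
  simp only [mul_inv, inv_inv, MulChar.mul_apply, ha, mulChar_inv_neg_one] at i1 i2 i3 i4
  simp only [div_eq_mul_inv, mul_inv, i1, i2, i3, i4]
  have hβ := mul_inv_cancel₀ (gS_ne_zero hψ β)
  have hγ := mul_inv_cancel₀ (gS_ne_zero hψ γ)
  generalize gS ψ (α' * β⁻¹ * γ⁻¹) = x₁, gS ψ ((α ^ 2)⁻¹ * β * γ) = x₂, gS ψ (α'⁻¹ * β) = x₃,
    gS ψ (α'⁻¹ * γ) = x₄, (gS ψ (α ^ 2))⁻¹ = y₁, gSo ψ (α ^ 2 * β⁻¹) = z₁,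
    gSo ψ (α ^ 2 * γ⁻¹) = z₂, (gS ψ β)⁻¹ = y₂, (gS ψ γ)⁻¹ = y₃, gS ψ β = x₅,
    gS ψ γ = x₆ at hβ hγ ⊢
  grind

/-- finite-field Dixon formula: in odd characteristic, if `α² ≠ βγ` and,
for each `α'` with `α'² = α²`, the multiset `{β,γ}` differs from `{ε,α'}`, then
`F(α²,β,γ;α²β̄,α²γ̄;1) = ∑_{α'²=α²} g°(α²β̄)g°(α²γ̄)g(α')g(α'β̄γ̄)/(g(α²)g(α²β̄γ̄)g°(α'β̄)g°(α'γ̄))`. -/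
theorem stmt_16 (hp : ringChar κ ≠ 2) (ψ : AddChar κ ℂ) (hψ : ψ ≠ 1)
    (α β γ : MulChar κ ℂ) (h1 : α ^ 2 ≠ β * γ)
    (h2 : ∀ α' : MulChar κ ℂ, α' ^ 2 = α ^ 2 →
      ({β, γ} : Multiset (MulChar κ ℂ)) ≠ {1, α'}) :
    Fh ψ ![α ^ 2, β, γ] ![α ^ 2 * β⁻¹, α ^ 2 * γ⁻¹] 1 =
      ∑ α' ∈ Finset.univ.filter (fun α' : MulChar κ ℂ => α' ^ 2 = α ^ 2),
        gSo ψ (α ^ 2 * β⁻¹) * gSo ψ (α ^ 2 * γ⁻¹) * gS ψ α' *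
            gS ψ (α' * β⁻¹ * γ⁻¹) /
          (gS ψ (α ^ 2) * gS ψ (α ^ 2 * β⁻¹ * γ⁻¹) * gSo ψ (α' * β⁻¹) *
            gSo ψ (α' * γ⁻¹)) := by
  have hq := one_sub_card_ne_zero (κ := κ)
  have hne : α ^ 2 * β⁻¹ * γ⁻¹ ≠ 1 := by
    rw [mul_assoc, ← mul_inv, ne_eq, mul_inv_eq_one]
    exact h1
  have h2' (α' : MulChar κ ℂ) (hα : α' ^ 2 = α ^ 2) (hm : α'⁻¹ * β * γ = 1) :
      β ≠ 1 ∧ γ ≠ 1 := by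
    rw [mul_assoc, inv_mul_eq_one] at hm
    constructor
    · rintro rfl
      exact h2 α' hα (by rw [hm, one_mul])
    · rintro rfl
      exact h2 α' hα (by rw [hm, mul_one, Multiset.pair_comm])
  rw [Fh, Finset.sum_congr rfl fun ν _ ↦ dixon_summand_eq hψ α β γ ν, ← Finset.mul_sum,
    sum_gS_dixon hp hψ _ β γ h1 h2', Finset.sum_congr rfl
      fun α' _ ↦ dixon_rhs_term_eq hψ hne α', ← Finset.mul_sum, ← Finset.mul_sum]
  rw [mul_left_comm, inv_mul_cancel_left₀ hq]

end
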